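/- Let α > 0, let q ≥ 0 be an integer, and let n ≥ 1 be an integer. For integers 0 ≤ i < j ≤ n, the polynomials P_{2n−2i+1}^{α+i−1,q+i} and P_{2n−2j+1}^{α+j−1,q+j} have only real zeros, and denoting by x_{2m+1,2m+1}^{β,r} the largest zero of P_{2m+1}^{β,r}, one has x_{2n−2j+1,2n−2j+1}^{α+j−1,q+j} < x_{2n−2i+1,2n−2i+1}^{α+i−1,q+i}. -/

import Mathlib

open MeasureTheory intervalIntegral Polynomial

/-- Pochhammer symbol `(a)_k = a (a+1) ⋯ (a+k-1)`. -/
noncomputable def poch (a : ℝ) (k : ℕ) : ℝ := ∏ i ∈ Finset.range k, (a + i)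

/-- `Peven α q n x = P_{2n}^{α,q}(x)`, the monic generalized Gegenbauer-type polynomial
`Σ_{k=0}^{n} (−n)_k (−n−q−1/2)_k / (k! (−2n−α−q−1/2)_k) x^{2n−2k}`. -/
noncomputable def Peven (α : ℝ) (q n : ℕ) (x : ℝ) : ℝ :=
  ∑ k ∈ Finset.range (n + 1),
    poch (-(n : ℝ)) k * poch (-(n : ℝ) - q - 1/2) k /
      ((Nat.factorial k : ℝ) * poch (-(2 * (n : ℝ)) - α - q - 1/2) k) * x ^ (2*n - 2*k)

/-- `Podd α q n x = P_{2n+1}^{α,q}(x) = (1+x) P_{2n}^{α+1,q}(x)`. -/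
noncomputable def Podd (α : ℝ) (q n : ℕ) (x : ℝ) : ℝ := (1 + x) * Peven (α + 1) q n x

/-- `P α q n x = P_n^{α,q}(x)`. -/
noncomputable def P (α : ℝ) (q : ℕ) (n : ℕ) (x : ℝ) : ℝ :=
  if Even n then Peven α q (n / 2) x else Podd α q (n / 2) x

theorem poch_zero (a : ℝ) : poch a 0 = 1 := by simp [poch]

theorem poch_succ (a : ℝ) (k : ℕ) : poch a (k + 1) = poch a k * (a + k) := by
  simp [poch, Finset.prod_range_succ]

theorem poch_succ' (a : ℝ) (k : ℕ) : poch a (k + 1) = a * poch (a + 1) k := by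
  simp only [poch, Finset.prod_range_succ', Nat.cast_zero, add_zero, mul_comm a]
  congr 1
  exact Finset.prod_congr rfl fun i _ => by push_cast; ring

theorem poch_ne_zero {a : ℝ} {k : ℕ} (h : a + k < 1) : poch a k ≠ 0 := by
  refine Finset.prod_ne_zero_iff.mpr fun i hi => ?_
  have : (i : ℝ) + 1 ≤ k := by exact_mod_cast Finset.mem_range.mp hi
  linarith

/-- The coefficient of `X ^ (m - k)` in the monic Jacobi polynomial of degree `m`. -/
noncomputable def jacobiCoeff (m : ℕ) (a b : ℝ) (k : ℕ) : ℝ :=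
  poch (-(m : ℝ)) k * poch (-(m : ℝ) - b) k /
    ((Nat.factorial k : ℝ) * poch (-(2 * (m : ℝ)) - a - b) k)

/-- The monic Jacobi polynomial for the weight `(1 - y) ^ a * y ^ b` on `[0, 1]`. -/
noncomputable def jacobi (m : ℕ) (a b : ℝ) : ℝ[X] :=
  ∑ k ∈ Finset.range (m + 1), C (jacobiCoeff m a b k) * X ^ (m - k)

theorem jacobiCoeff_zero (m : ℕ) (a b : ℝ) : jacobiCoeff m a b 0 = 1 := by
  simp [jacobiCoeff, poch_zero]

theorem jacobiCoeff_self_succ (m : ℕ) (a b : ℝ) : jacobiCoeff m a b (m + 1) = 0 := by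
  simp [jacobiCoeff, poch_succ]

theorem eval_jacobi (m : ℕ) (a b x : ℝ) :
    (jacobi m a b).eval x = ∑ k ∈ Finset.range (m + 1), jacobiCoeff m a b k * x ^ (m - k) := by
  simp [jacobi, eval_finsetSum]

theorem Peven_eq_eval_jacobi (a : ℝ) (q m : ℕ) (x : ℝ) :
    Peven a q m x = (jacobi m a (q + 1 / 2)).eval (x ^ 2) := by
  rw [eval_jacobi, Peven]
  refine Finset.sum_congr rfl fun k _ => ?_
  rw [jacobiCoeff, ← pow_mul, Nat.mul_sub, sub_sub (-(m : ℝ)),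
    sub_sub _ (q : ℝ)]

theorem jacobi_monic_natDegree (m : ℕ) (a b : ℝ) :
    (jacobi m a b).Monic ∧ (jacobi m a b).natDegree = m := by
  have h : jacobi m a b = X ^ m +
      ∑ k ∈ Finset.range m, C (jacobiCoeff m a b (k + 1)) * X ^ (m - (k + 1)) := by
    rw [jacobi, Finset.sum_range_succ', jacobiCoeff_zero, add_comm]
    simp
  have hlt : (∑ k ∈ Finset.range m,
      C (jacobiCoeff m a b (k + 1)) * X ^ (m - (k + 1))).degree < (m : WithBot ℕ) := by
    refine (degree_sum_le _ _).trans_lt ((Finset.sup_lt_iff (WithBot.bot_lt_coe m)).mpr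
      fun k hk => (degree_C_mul_X_pow_le _ _).trans_lt ?_)
    have := Finset.mem_range.mp hk
    exact Nat.cast_lt.mpr (by omega)
  rw [h]
  exact ⟨monic_X_pow_add hlt, natDegree_eq_of_degree_eq_some (by
    rw [degree_add_eq_left_of_degree_lt (by rwa [degree_X_pow]), degree_X_pow])⟩

theorem derivative_jacobi (m : ℕ) (a b : ℝ) :
    derivative (jacobi (m + 1) a b) = C ((m : ℝ) + 1) * jacobi m (a + 1) (b + 1) := by
  rw [jacobi, jacobi, Finset.sum_range_succ, derivative_add, derivative_sum, Finset.mul_sum]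
  simp only [Nat.sub_self, pow_zero, mul_one, derivative_C, add_zero]
  refine Finset.sum_congr rfl fun k hk => ?_
  have hk' : k ≤ m := Nat.lt_succ_iff.mp (Finset.mem_range.mp hk)
  rw [derivative_C_mul_X_pow, ← mul_assoc, ← C_mul]
  have e : m + 1 - k - 1 = m - k := by omega
  rw [e, Nat.cast_sub (by omega)]
  congr 2
  have h1 : poch (-((m + 1 : ℕ) : ℝ)) k * (((m + 1 : ℕ) : ℝ) - k) = (m + 1) * poch (-(m : ℝ)) k := by
    have h := (poch_succ (-((m + 1 : ℕ) : ℝ)) k).symm.trans (poch_succ' _ _)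
    push_cast at h ⊢
    rw [show -((m : ℝ) + 1) + 1 = -m by ring] at h
    linarith
  have h2 : -((m + 1 : ℕ) : ℝ) - b = -(m : ℝ) - (b + 1) := by push_cast; ring
  have h3 : -(2 * ((m + 1 : ℕ) : ℝ)) - a - b = -(2 * (m : ℝ)) - (a + 1) - (b + 1) := by
    push_cast; ring
  rw [jacobiCoeff, jacobiCoeff, h2, h3, div_mul_eq_mul_div, mul_right_comm, h1, mul_assoc,
    mul_div_assoc]

theorem jacobiCoeff_succ_mul {m k : ℕ} {a b : ℝ} (ha : -1 < a) (hb : -1 < b) (hk : k ≤ m) :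
    (m + a + b + 2) * jacobiCoeff (m + 1) a b (k + 1) =
      (m - (k + 1 : ℕ) + a + b + 2) * jacobiCoeff m (a + 1) (b + 1) (k + 1)
        - (m - k + b + 1) * jacobiCoeff m (a + 1) (b + 1) k := by
  have hk' : (k : ℝ) ≤ m := by exact_mod_cast hk
  have h2 : -((m + 1 : ℕ) : ℝ) - b = -(m : ℝ) - (b + 1) := by push_cast; ring
  have h3 : -(2 * ((m + 1 : ℕ) : ℝ)) - a - b = -(2 * (m : ℝ)) - (a + 1) - (b + 1) := by
    push_cast; ring
  have h4 : -((m + 1 : ℕ) : ℝ) + 1 = -m := by push_cast; ring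
  have hp : poch (-(2 * (m : ℝ)) - (a + 1) - (b + 1)) k ≠ 0 := poch_ne_zero (by linarith)
  have hq : -(2 * (m : ℝ)) - (a + 1) - (b + 1) + k ≠ 0 := by linarith
  have hf : (Nat.factorial k : ℝ) ≠ 0 := by positivity
  have hk1 : (k : ℝ) + 1 ≠ 0 := by positivity
  rw [jacobiCoeff, jacobiCoeff, jacobiCoeff, h2, h3, poch_succ' (-((m + 1 : ℕ) : ℝ)), h4,
    poch_succ, poch_succ, poch_succ, Nat.factorial_succ]
  push_cast
  generalize poch (-(m : ℝ)) k = u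
  generalize poch (-(m : ℝ) - (b + 1)) k = v
  generalize poch (-(2 * (m : ℝ)) - (a + 1) - (b + 1)) k = w at *
  generalize hr : -(2 * (m : ℝ)) - (a + 1) - (b + 1) + k = r at *
  obtain rfl : a = k - 2 * m - b - 2 - r := by linarith
  field_simp
  ring

theorem X_mul_derivative_jacobi_eval (m : ℕ) (a b x : ℝ) :
    x * (derivative (jacobi m a b)).eval x =
      ∑ k ∈ Finset.range (m + 1), (m - k : ℝ) * jacobiCoeff m a b k * x ^ (m - k) := by
  rw [jacobi, derivative_sum, eval_finsetSum, Finset.mul_sum]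
  refine Finset.sum_congr rfl fun k hk => ?_
  have hk' : k ≤ m := Nat.lt_succ_iff.mp (Finset.mem_range.mp hk)
  rw [derivative_C_mul_X_pow, ← Nat.cast_sub hk']
  rcases hd : m - k with _ | d
  · simp
  · simp only [eval_mul, eval_C, eval_pow, eval_X, Nat.add_sub_cancel]
    ring

/-- The raising operator for Jacobi polynomials. -/
theorem jacobi_raising {a b : ℝ} (ha : -1 < a) (hb : -1 < b) (m : ℕ) (x : ℝ) :
    x * (1 - x) * (derivative (jacobi m (a + 1) (b + 1))).eval x
      + ((b + 1) * (1 - x) - (a + 1) * x) * (jacobi m (a + 1) (b + 1)).eval x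
      = -(m + a + b + 2) * (jacobi (m + 1) a b).eval x := by
  set c := jacobiCoeff m (a + 1) (b + 1) with hc
  have hshift : ∑ k ∈ Finset.range (m + 1), (m - k + a + b + 2 : ℝ) * c k * x ^ (m + 1 - k) =
      ∑ k ∈ Finset.range (m + 1), (m - (k + 1 : ℕ) + a + b + 2 : ℝ) * c (k + 1) * x ^ (m - k)
        + (m + a + b + 2) * x ^ (m + 1) := by
    have h := Finset.sum_range_succ' (fun k : ℕ =>
      (m - k + a + b + 2 : ℝ) * c k * x ^ (m + 1 - k)) (m + 1)
    rw [Finset.sum_range_succ] at h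
    simpa [hc, jacobiCoeff_self_succ, jacobiCoeff_zero] using h
  have hleft : x * (1 - x) * (derivative (jacobi m (a + 1) (b + 1))).eval x
      + ((b + 1) * (1 - x) - (a + 1) * x) * (jacobi m (a + 1) (b + 1)).eval x =
      ∑ k ∈ Finset.range (m + 1), (m - k + b + 1 : ℝ) * c k * x ^ (m - k)
      - ∑ k ∈ Finset.range (m + 1), (m - k + a + b + 2 : ℝ) * c k * x ^ (m + 1 - k) := by
    rw [show ∀ u : ℝ, x * (1 - x) * u = (1 - x) * (x * u) from fun u => by ring,
      X_mul_derivative_jacobi_eval, eval_jacobi, Finset.mul_sum, Finset.mul_sum,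
      ← Finset.sum_add_distrib, ← Finset.sum_sub_distrib]
    refine Finset.sum_congr rfl fun k hk => ?_
    have hk' : k ≤ m := Nat.lt_succ_iff.mp (Finset.mem_range.mp hk)
    rw [Nat.succ_sub hk', pow_succ]
    ring
  rw [hleft, hshift, eval_jacobi, Finset.sum_range_succ' _ (m + 1), jacobiCoeff_zero, mul_add,
    Finset.mul_sum, sub_add_eq_sub_sub, ← Finset.sum_sub_distrib]
  have hterm : ∑ k ∈ Finset.range (m + 1), ((m - k + b + 1 : ℝ) * c k * x ^ (m - k)
      - (m - (k + 1 : ℕ) + a + b + 2 : ℝ) * c (k + 1) * x ^ (m - k)) =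
      ∑ k ∈ Finset.range (m + 1), -(m + a + b + 2) *
        (jacobiCoeff (m + 1) a b (k + 1) * x ^ (m + 1 - (k + 1))) := by
    refine Finset.sum_congr rfl fun k hk => ?_
    have hk' : k ≤ m := Nat.lt_succ_iff.mp (Finset.mem_range.mp hk)
    have h := jacobiCoeff_succ_mul ha hb hk'
    rw [Nat.add_sub_add_right]
    linear_combination x ^ (m - k) * h
  rw [hterm]
  simp
  ring

theorem hasDerivAt_weight_mul {a b x : ℝ} (p : ℝ[X]) (hx0 : 0 < x) (hx1 : x < 1) :
    HasDerivAt (fun y : ℝ => y ^ (b + 1) * (1 - y) ^ (a + 1) * p.eval y)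
      (x ^ b * (1 - x) ^ a * (x * (1 - x) * (derivative p).eval x
        + ((b + 1) * (1 - x) - (a + 1) * x) * p.eval x)) x := by
  have h1 : HasDerivAt (fun y : ℝ => y ^ (b + 1)) ((b + 1) * x ^ b) x := by
    simpa using Real.hasDerivAt_rpow_const (p := b + 1) (Or.inl hx0.ne')
  have h2 : HasDerivAt (fun y : ℝ => (1 - y) ^ (a + 1)) (-((a + 1) * (1 - x) ^ a)) x := by
    refine (((hasDerivAt_id x).const_sub 1).rpow_const (p := a + 1)
      (Or.inl (sub_pos.mpr hx1).ne')).congr_deriv ?_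
    rw [add_sub_cancel_right, id]
    ring
  refine ((h1.mul h2).mul (p.hasDerivAt x)).congr_deriv ?_
  rw [Pi.mul_apply, Real.rpow_add_one hx0.ne', Real.rpow_add_one (sub_pos.mpr hx1).ne']
  ring

/-- The raising operator adds a zero in `(0, 1)`, by Rolle's theorem. -/
theorem exists_raising_zero {a b : ℝ} (ha : -1 < a) (hb : -1 < b) (p : ℝ[X]) {u v : ℝ}
    (hu : 0 ≤ u) (huv : u < v) (hv : v ≤ 1) (hpu : u = 0 ∨ p.eval u = 0)
    (hpv : v = 1 ∨ p.eval v = 0) :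
    ∃ x ∈ Set.Ioo u v, x * (1 - x) * (derivative p).eval x
        + ((b + 1) * (1 - x) - (a + 1) * x) * p.eval x = 0 := by
  have ha' : 0 < a + 1 := by linarith
  have hb' : 0 < b + 1 := by linarith
  have hcont : Continuous (fun y : ℝ => y ^ (b + 1) * (1 - y) ^ (a + 1) * p.eval y) :=
    ((Real.continuous_rpow_const hb'.le).mul
      ((Real.continuous_rpow_const ha'.le).comp (continuous_const.sub continuous_id))).mul
      p.continuous
  have hfu : u ^ (b + 1) * (1 - u) ^ (a + 1) * p.eval u = 0 := by
    rcases hpu with h | h <;> simp [h, Real.zero_rpow hb'.ne']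
  have hfv : v ^ (b + 1) * (1 - v) ^ (a + 1) * p.eval v = 0 := by
    rcases hpv with h | h <;> simp [h, Real.zero_rpow ha'.ne']
  obtain ⟨x, hx, h⟩ := exists_hasDerivAt_eq_zero huv hcont.continuousOn (hfu.trans hfv.symm)
    fun x hx => hasDerivAt_weight_mul p (hu.trans_lt hx.1) (hx.2.trans_le hv)
  refine ⟨x, hx, (mul_eq_zero.mp h).resolve_left (mul_pos ?_ ?_).ne'⟩
  · exact Real.rpow_pos_of_pos (hu.trans_lt hx.1) _
  · exact Real.rpow_pos_of_pos (sub_pos.mpr (hx.2.trans_le hv)) _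

theorem exists_jacobi_eq_prod (m : ℕ) {a b : ℝ} (ha : -1 < a) (hb : -1 < b) :
    ∃ s : Finset ℝ, s.card = m ∧ (∀ z ∈ s, 0 < z ∧ z < 1) ∧
      jacobi m a b = ∏ z ∈ s, (X - C z) := by
  induction m generalizing a b with
  | zero => exact ⟨∅, by simp [jacobi, jacobiCoeff_zero]⟩
  | succ m ih =>
    obtain ⟨s, hs, hs01, hprod⟩ := ih (a := a + 1) (b := b + 1) (by linarith) (by linarith)
    obtain ⟨hmonic, hdeg⟩ := jacobi_monic_natDegree (m + 1) a b
    have hpos : (0 : ℝ) < m + a + b + 2 := by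
      have : (0 : ℝ) ≤ m := m.cast_nonneg
      linarith
    have hroot : ∀ z ∈ s, (jacobi m (a + 1) (b + 1)).eval z = 0 := fun z hz => by
      rw [hprod, eval_prod]
      exact Finset.prod_eq_zero hz (by simp)
    have h0 : (0 : ℝ) ∉ insert 1 s := by
      simp only [Finset.mem_insert, not_or]
      exact ⟨by norm_num, fun h => (hs01 0 h).1.false⟩
    have h1 : (1 : ℝ) ∉ s := fun h => (hs01 1 h).2.false
    set t := (jacobi (m + 1) a b).roots.toFinset.filter (fun z => 0 < z ∧ z < 1) with ht
    have hcard : m + 1 ≤ t.card := by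
      have hle : (insert 0 (insert 1 s)).card ≤ t.card + 1 := by
        refine Finset.card_le_of_interleaved fun u hu v hv huv _ => ?_
        simp only [Finset.mem_insert] at hu hv
        have hu0 : 0 ≤ u := by
          rcases hu with h | h | h
          exacts [h.ge, by rw [h]; norm_num, (hs01 u h).1.le]
        have hv1 : v ≤ 1 := by
          rcases hv with h | h | h
          exacts [by rw [h]; norm_num, h.le, (hs01 v h).2.le]
        obtain ⟨x, hx, hx0⟩ := exists_raising_zero ha hb (jacobi m (a + 1) (b + 1)) hu0 huv hv1
          (hu.imp_right fun h => h.elim (fun h => by linarith) (hroot u))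
          (hv.elim (fun h => by linarith) (Or.imp_right (hroot v)))
        rw [jacobi_raising ha hb] at hx0
        refine ⟨x, ?_, hx⟩
        simp only [ht, Finset.mem_filter, Multiset.mem_toFinset, mem_roots hmonic.ne_zero, IsRoot]
        exact ⟨(mul_eq_zero.mp hx0).resolve_left (neg_ne_zero.mpr hpos.ne'),
          hu0.trans_lt hx.1, hx.2.trans_le hv1⟩
      rw [Finset.card_insert_of_notMem h0, Finset.card_insert_of_notMem h1, hs] at hle
      omega
    have hval : t.val = (jacobi (m + 1) a b).roots := by
      refine Multiset.eq_of_le_of_card_le ?_ ((card_roots' _).trans (hdeg.le.trans hcard))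
      exact Finset.val_le_iff_val_subset.mpr fun z hz => by
        simpa using (Finset.mem_filter.mp (Finset.mem_val.mp hz)).1
    have hroots : (jacobi (m + 1) a b).roots.card = (jacobi (m + 1) a b).natDegree := by
      refine le_antisymm (card_roots' _) ?_
      rw [hdeg, ← hval]
      exact hcard
    refine ⟨t, ?_, fun z hz => (Finset.mem_filter.mp hz).2, ?_⟩
    · rw [← hdeg, ← hroots, ← hval]
      rfl
    · rw [← prod_multiset_X_sub_C_of_monic_of_roots_card_eq hmonic hroots, ← hval]
      rfl

/-- If a nonempty product of distinct linear factors is differentiated, every zero of the result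
lies below some zero of the product. -/
theorem exists_lt_of_derivative_prod_eval_eq_zero {s : Finset ℝ} (hs : s.Nonempty) {r : ℝ}
    (hr : (derivative (∏ z ∈ s, (X - C z))).eval r = 0) : ∃ z ∈ s, r < z := by
  by_contra! h
  obtain ⟨w, hw, hmax⟩ := s.exists_max_image id hs
  rw [derivative_prod_finset, eval_finsetSum] at hr
  simp only [derivative_X_sub_C, mul_one, eval_prod, eval_sub, eval_X, eval_C] at hr
  rw [Finset.sum_eq_zero_iff_of_nonneg fun i _ => Finset.prod_nonneg fun z hz =>
    sub_nonneg.mpr (h z (Finset.mem_of_mem_erase hz))] at hr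
  refine (Finset.prod_pos fun z hz => ?_).ne' (hr w hw)
  have hz' := Finset.mem_erase.mp hz
  exact sub_pos.mpr (((hmax z hz'.2).lt_of_ne hz'.1).trans_le (h w hw))

theorem exists_jacobi_zero_gt_of_succ {m : ℕ} {a b r : ℝ} (ha : -1 < a) (hb : -1 < b)
    (hr : (jacobi m (a + 1) (b + 1)).eval r = 0) :
    ∃ z, (jacobi (m + 1) a b).eval z = 0 ∧ r < z := by
  obtain ⟨s, hs, -, hprod⟩ := exists_jacobi_eq_prod (m + 1) ha hb
  obtain ⟨z, hz, hrz⟩ := exists_lt_of_derivative_prod_eval_eq_zero (s := s) (r := r)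
    (Finset.card_pos.mp (by omega)) (by rw [← hprod, derivative_jacobi, eval_mul, hr, mul_zero])
  refine ⟨z, ?_, hrz⟩
  rw [hprod, eval_prod]
  exact Finset.prod_eq_zero hz (by simp)

theorem exists_jacobi_zero_gt {m d : ℕ} {a b r : ℝ} (ha : -1 < a) (hb : -1 < b)
    (hr : (jacobi m (a + (d + 1 : ℕ)) (b + (d + 1 : ℕ))).eval r = 0) :
    ∃ z, (jacobi (m + (d + 1)) a b).eval z = 0 ∧ r < z := by
  have hstep : ∀ d : ℕ, a + (d + 1 : ℕ) = a + d + 1 ∧ b + (d + 1 : ℕ) = b + d + 1 :=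
    fun d => by push_cast; exact ⟨by ring, by ring⟩
  have hpos : ∀ d : ℕ, -1 < a + d ∧ -1 < b + d := fun d => by
    have : (0 : ℝ) ≤ d := d.cast_nonneg
    exact ⟨by linarith, by linarith⟩
  rw [(hstep d).1, (hstep d).2] at hr
  obtain ⟨y, hy, hry⟩ := exists_jacobi_zero_gt_of_succ (hpos d).1 (hpos d).2 hr
  induction d generalizing m r y with
  | zero => exact ⟨y, by simpa using hy, hry⟩
  | succ d ih =>
    rw [(hstep d).1, (hstep d).2] at hy
    obtain ⟨y', hy', hyy'⟩ := exists_jacobi_zero_gt_of_succ (hpos d).1 (hpos d).2 hy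
    obtain ⟨z, hz, hz'⟩ := ih hy y' hy' hyy'
    exact ⟨z, by rwa [show m + (d + 1 + 1) = m + 1 + (d + 1) by ring], hry.trans hz'⟩

/-- The zeros of `(1 + x) * ∏ z ∈ s, (x ^ 2 - z)`. -/
noncomputable def sqrtZeros (s : Finset ℝ) : Multiset ℝ :=
  -1 ::ₘ (s.val.map (fun z => √z) + s.val.map (fun z => -√z))

theorem card_sqrtZeros (s : Finset ℝ) : Multiset.card (sqrtZeros s) = 2 * s.card + 1 := by
  simp [sqrtZeros, two_mul]

theorem prod_sqrtZeros {s : Finset ℝ} (hs : ∀ z ∈ s, 0 < z ∧ z < 1) (x : ℝ) :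
    ((sqrtZeros s).map (fun y => x - y)).prod = (1 + x) * ∏ z ∈ s, (x ^ 2 - z) := by
  simp only [sqrtZeros, Multiset.map_cons, Multiset.prod_cons, Multiset.map_add,
    Multiset.prod_add, Multiset.map_map, Function.comp_apply]
  change _ * ((∏ z ∈ s, (x - √z)) * ∏ z ∈ s, (x - -√z)) = _
  rw [← Finset.prod_mul_distrib, sub_neg_eq_add, add_comm x]
  congr 1
  refine Finset.prod_congr rfl fun z hz => ?_
  linear_combination -Real.sq_sqrt (hs z hz).1.le

theorem mem_sqrtZeros {s : Finset ℝ} {x : ℝ} :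
    x ∈ sqrtZeros s ↔ x = -1 ∨ (∃ z ∈ s, √z = x) ∨ ∃ z ∈ s, -√z = x := by
  simp [sqrtZeros]

theorem exists_max_sqrtZeros (s : Finset ℝ) :
    ∃ a ∈ sqrtZeros s, ∀ t ∈ sqrtZeros s, t ≤ a := by
  simpa using (sqrtZeros s).toFinset.exists_max_image id
    ⟨-1, by simp [mem_sqrtZeros]⟩

/-- For `0 ≤ i < j ≤ n` and `α > 0`, the polynomials `P_{2n−2i+1}^{α+i−1,q+i}` and
`P_{2n−2j+1}^{α+j−1,q+j}` have only real zeros, and the largest zero of the latter is strictly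
smaller than the largest zero of the former. -/
theorem largest_zero_monotone_odd (α : ℝ) (hα : 0 < α) (q : ℕ) (n : ℕ) (hn : 1 ≤ n)
    (i j : ℕ) (hij : i < j) (hj : j ≤ n) :
    ∃ S T : Multiset ℝ,
      Multiset.card S = 2 * (n - i) + 1 ∧ Multiset.card T = 2 * (n - j) + 1 ∧
      (∀ x : ℝ, Podd (α + i - 1) (q + i) (n - i) x = (S.map (fun s => x - s)).prod) ∧
      (∀ x : ℝ, Podd (α + j - 1) (q + j) (n - j) x = (T.map (fun s => x - s)).prod) ∧
      ∃ a b : ℝ, a ∈ T ∧ b ∈ S ∧ (∀ t ∈ T, t ≤ a) ∧ (∀ t ∈ S, t ≤ b) ∧ a < b := by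
  have hodd : ∀ k : ℕ, ∃ s : Finset ℝ, s.card = n - k ∧ (∀ z ∈ s, 0 < z ∧ z < 1) ∧
      jacobi (n - k) (α + k) ((q + k : ℕ) + 1 / 2) = ∏ z ∈ s, (X - C z) := fun k =>
    exists_jacobi_eq_prod _ (lt_of_lt_of_le (by norm_num) (by positivity : 0 ≤ α + k))
      (lt_of_lt_of_le (by norm_num) (by positivity : (0 : ℝ) ≤ ((q + k : ℕ) : ℝ) + 1 / 2))
  have hfac : ∀ (k : ℕ) (s : Finset ℝ), (∀ z ∈ s, 0 < z ∧ z < 1) →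
      jacobi (n - k) (α + k) ((q + k : ℕ) + 1 / 2) = ∏ z ∈ s, (X - C z) → ∀ x : ℝ,
      Podd (α + k - 1) (q + k) (n - k) x = ((sqrtZeros s).map (fun y => x - y)).prod := by
    intro k s h01 hs x
    rw [prod_sqrtZeros h01, Podd, sub_add_cancel, Peven_eq_eval_jacobi, hs, eval_prod]
    simp
  obtain ⟨s, hs, hs01, hsp⟩ := hodd i
  obtain ⟨t, ht, ht01, htp⟩ := hodd j
  obtain ⟨a, haT, hamax⟩ := exists_max_sqrtZeros t
  obtain ⟨b, hbS, hbmax⟩ := exists_max_sqrtZeros s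
  refine ⟨sqrtZeros s, sqrtZeros t, by rw [card_sqrtZeros, hs], by rw [card_sqrtZeros, ht],
    hfac i s hs01 hsp, hfac j t ht01 htp, a, b, haT, hbS, hamax, hbmax, ?_⟩
  obtain ⟨w, hw⟩ : s.Nonempty := Finset.card_pos.mp (by omega)
  have hwb : 0 < b := (Real.sqrt_pos.mpr (hs01 w hw).1).trans_le
    (hbmax _ (mem_sqrtZeros.mpr (Or.inr (Or.inl ⟨w, hw, rfl⟩))))
  rcases mem_sqrtZeros.mp haT with rfl | ⟨r, hr, rfl⟩ | ⟨r, hr, rfl⟩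
  · linarith
  · obtain ⟨d, rfl⟩ : ∃ d, j = i + (d + 1) := ⟨j - i - 1, by omega⟩
    have hroot : (jacobi (n - (i + (d + 1))) (α + i + (d + 1 : ℕ))
        ((q + i : ℕ) + 1 / 2 + (d + 1 : ℕ))).eval r = 0 := by
      have e : (jacobi (n - (i + (d + 1))) (α + (i + (d + 1) : ℕ))
          ((q + (i + (d + 1)) : ℕ) + 1 / 2)).eval r = 0 := by
        rw [htp, eval_prod]
        exact Finset.prod_eq_zero hr (by simp)
      convert e using 3 <;> push_cast <;> ring
    obtain ⟨z, hz, hrz⟩ := exists_jacobi_zero_gt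
      (lt_of_lt_of_le (by norm_num) (by positivity : 0 ≤ α + i))
      (lt_of_lt_of_le (by norm_num) (by positivity : (0 : ℝ) ≤ ((q + i : ℕ) : ℝ) + 1 / 2)) hroot
    rw [show n - (i + (d + 1)) + (d + 1) = n - i by omega, hsp, eval_prod,
      Finset.prod_eq_zero_iff] at hz
    obtain ⟨y, hy, hzy⟩ := hz
    have hzs : z = y := sub_eq_zero.mp (by simpa using hzy)
    exact (Real.sqrt_lt_sqrt (ht01 r hr).1.le hrz).trans_le
      (hbmax _ (mem_sqrtZeros.mpr (Or.inr (Or.inl ⟨y, hy, by rw [hzs]⟩))))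
  · linarith [Real.sqrt_nonneg r]
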